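/- (Asymptotics of the symmetric-power constant) Fix an integer n ≥ 1. For integers ℓ ≥ 1 define log γ_{n,ℓ} := binom(ℓ+n−1, n−1)^{-1} · ∑_{𝐢} log(ℓ! / (i₁! ⋯ iₙ!)), the sum being over all 𝐢 = (i₁, …, iₙ) ∈ ℕⁿ with i₁ + ⋯ + iₙ = ℓ. Let Hₙ = ∑_{i=1}^{n} 1/i be the n-th harmonic number. Then (log γ_{n,ℓ}) / ℓ → Hₙ − 1 as ℓ → ∞. -/

import Mathlib

open Filter

open PowerSeries in
theorem coeff_mk_mul_mk_one (f : ℕ → ℝ) (l : ℕ) :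
    coeff l (mk f * mk 1) = ∑ k ∈ Finset.range (l + 1), f k := by
  simp [coeff_mul, Finset.Nat.sum_antidiagonal_eq_sum_range_succ_mk]

theorem sum_antidiagonalTuple_succ {M : Type*} [AddCommMonoid M] (n l : ℕ)
    (f : (Fin (n + 1) → ℕ) → M) :
    ∑ i ∈ Finset.Nat.antidiagonalTuple (n + 1) l, f i =
      ∑ x ∈ Finset.HasAntidiagonal.antidiagonal l,
        ∑ i ∈ Finset.Nat.antidiagonalTuple n x.2, f (Fin.cons x.1 i) := by
  rw [Finset.sum_sigma']
  refine Finset.sum_bij'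
    (fun i _ => ⟨(i 0, ∑ j, Fin.tail i j), Fin.tail i⟩) (fun y _ => Fin.cons y.1.1 y.2)
    ?_ ?_ ?_ ?_ ?_
  · intro i hi
    simp only [Finset.Nat.mem_antidiagonalTuple, Fin.sum_univ_succ] at hi
    simp [Finset.Nat.mem_antidiagonalTuple, Fin.tail, hi]
  · rintro ⟨⟨a, b⟩, i⟩ h
    simp only [Finset.mem_sigma, Finset.HasAntidiagonal.mem_antidiagonal, Finset.Nat.mem_antidiagonalTuple] at h
    simp [Finset.Nat.mem_antidiagonalTuple, Fin.sum_univ_succ, h]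
  · intro i _
    simp
  · rintro ⟨⟨a, b⟩, i⟩ h
    simp only [Finset.mem_sigma, Finset.HasAntidiagonal.mem_antidiagonal, Finset.Nat.mem_antidiagonalTuple] at h
    simp [h.2]
  · intro i _
    simp

open PowerSeries in
theorem card_antidiagonalTuple_eq_coeff (n l : ℕ) :
    ((Finset.Nat.antidiagonalTuple n l).card : ℝ) = coeff l ((mk 1 : ℝ⟦X⟧) ^ n) := by
  induction n generalizing l with
  | zero => cases l <;> simp [coeff_one]
  | succ n ih =>
    rw [pow_succ', coeff_mul, Finset.card_eq_sum_ones, sum_antidiagonalTuple_succ]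
    simp [← ih]

open PowerSeries in
theorem sum_antidiagonalTuple_sum_eq_coeff (g : ℕ → ℝ) (n l : ℕ) :
    ∑ i ∈ Finset.Nat.antidiagonalTuple n l, ∑ j, g (i j) =
      n * coeff l (mk g * (mk 1 : ℝ⟦X⟧) ^ (n - 1)) := by
  induction n generalizing l with
  | zero => simp
  | succ n ih =>
    have hstep : ∑ i ∈ Finset.Nat.antidiagonalTuple (n + 1) l, ∑ j, g (i j) =
        coeff l (mk g * (mk 1 : ℝ⟦X⟧) ^ n) +
          n * coeff l (mk 1 * (mk g * (mk 1 : ℝ⟦X⟧) ^ (n - 1))) := by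
      simp only [coeff_mul l (mk g), coeff_mul l (mk 1), Finset.mul_sum,
        ← Finset.sum_add_distrib, sum_antidiagonalTuple_succ]
      refine Finset.sum_congr rfl fun x _ => ?_
      simp only [Fin.sum_univ_succ, Fin.cons_zero, Fin.cons_succ, Finset.sum_add_distrib, ih,
        ← card_antidiagonalTuple_eq_coeff, Finset.sum_const, nsmul_eq_mul, coeff_mk,
        Pi.one_apply, one_mul]
      ring
    rw [hstep]
    rcases n with _ | n
    · simp
    · rw [mul_left_comm, ← pow_succ']
      push_cast
      ring

open PowerSeries in
theorem coeff_mk_one_pow_succ (p l : ℕ) :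
    coeff l ((mk 1 : ℝ⟦X⟧) ^ (p + 1)) = ((l + p).choose p : ℝ) := by
  rw [mk_one_pow_eq_mk_choose_add, coeff_mk, add_comm]

open PowerSeries in
theorem mk_log_mul_mk_one :
    (mk fun k : ℕ => Real.log k) * mk 1 = mk fun k : ℕ => Real.log k.factorial := by
  ext l
  rw [coeff_mk_mul_mk_one, coeff_mk]
  induction l with
  | zero => simp
  | succ l ih =>
    rw [Finset.sum_range_succ, ih, Nat.factorial_succ, Nat.cast_mul, Real.log_mul, add_comm]
    · positivity
    · positivity

open PowerSeries in
theorem coeff_mk_harmonic_mul_mk_one_pow (n l : ℕ) :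
    coeff l ((mk fun k : ℕ => (harmonic k : ℝ)) * (mk 1 : ℝ⟦X⟧) ^ n) =
      (l + n).choose n * ((harmonic (l + n) : ℝ) - harmonic n) := by
  suffices h : (mk fun k : ℕ => (harmonic k : ℝ)) * (mk 1 : ℝ⟦X⟧) ^ n =
      mk fun l : ℕ => ((l + n).choose n * ((harmonic (l + n) : ℝ) - harmonic n) : ℝ) by
    rw [h, coeff_mk]
  induction n with
  | zero => simp
  | succ n ih =>
    rw [pow_succ, ← mul_assoc, ih]
    ext l
    rw [coeff_mk_mul_mk_one, coeff_mk]
    induction l with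
    | zero => simp
    | succ l ihl =>
      have h1 : ((l + 1 + (n + 1)).choose (n + 1) : ℝ) =
          (l + 1 + n).choose n + (l + (n + 1)).choose (n + 1) := by
        rw [show l + 1 + (n + 1) = (l + 1 + n) + 1 by ring, Nat.choose_succ_succ,
          show l + (n + 1) = l + 1 + n by ring]
        push_cast
        ring
      have h2 : ((l + 1 + (n + 1) : ℕ) : ℝ) * (l + 1 + n).choose n =
          (l + 1 + (n + 1)).choose (n + 1) * (n + 1) := by
        exact_mod_cast Nat.add_one_mul_choose_eq (l + 1 + n) n
      rw [Finset.sum_range_succ, ihl, show l + (n + 1) = l + 1 + n by ring,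
        show l + 1 + (n + 1) = (l + 1 + n) + 1 by ring, harmonic_succ, harmonic_succ]
      rw [show l + (n + 1) = l + 1 + n by ring] at h1
      rw [show l + 1 + (n + 1) = (l + 1 + n) + 1 by ring] at h1 h2
      have h3 : (((l + 1 + n) + 1 : ℕ) : ℝ) ≠ 0 := by positivity
      have h4 : ((n + 1 : ℕ) : ℝ) ≠ 0 := by positivity
      push_cast at h1 h2 h3 h4 ⊢
      have h5 : (((l + 1 + n) + 1).choose (n + 1) : ℝ) * ((l : ℝ) + 1 + n + 1)⁻¹ =
          (l + 1 + n).choose n * ((n : ℝ) + 1)⁻¹ := by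
        field_simp
        linarith
      linear_combination
        ((n + 1 : ℝ)⁻¹ - (harmonic (l + 1 + n) - harmonic n)) * h1 - h5

open PowerSeries in
theorem abs_coeff_mk_mul_mk_one_pow_succ_le (f : ℕ → ℝ) (p l : ℕ) :
    |coeff l (mk f * (mk 1 : ℝ⟦X⟧) ^ (p + 1))| ≤
      (l + p).choose p * ∑ k ∈ Finset.range (l + 1), |f k| := by
  rw [coeff_mul, Finset.mul_sum, Finset.Nat.sum_antidiagonal_eq_sum_range_succ_mk]
  refine (Finset.abs_sum_le_sum_abs _ _).trans (Finset.sum_le_sum fun k _ => ?_)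
  rw [coeff_mk_one_pow_succ, coeff_mk, abs_mul, Nat.abs_cast, mul_comm]
  gcongr
  omega

theorem tendsto_inv_mul_sum_range_succ_of_tendsto_zero {u : ℕ → ℝ}
    (hu : Tendsto u atTop (nhds 0)) :
    Tendsto (fun l : ℕ => (l : ℝ)⁻¹ * ∑ k ∈ Finset.range (l + 1), u k) atTop (nhds 0) := by
  have h := hu.cesaro.add ((tendsto_inv_atTop_nhds_zero_nat (𝕜 := ℝ)).mul hu)
  simpa [Finset.sum_range_succ, mul_add] using h

open PowerSeries in
theorem tendsto_coeff_mk_log_mul_mk_one_pow (p : ℕ) :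
    Tendsto (fun l : ℕ =>
      (p + 1) * coeff l ((mk fun k : ℕ => Real.log k) * (mk 1 : ℝ⟦X⟧) ^ (p + 1)) /
        (l + p).choose p / l - Real.log l) atTop (nhds (-(harmonic (p + 1) : ℝ))) := by
  set γ := Real.eulerMascheroniConstant
  set ε : ℕ → ℝ := fun k => Real.log k - harmonic k + γ with hε
  have hε0 : Tendsto ε atTop (nhds 0) := by
    have h := (Real.tendsto_harmonic_sub_log.neg).add_const γ
    simpa [hε, γ] using h
  have hlog (l : ℕ) :
      (p + 1) * coeff l ((mk fun k : ℕ => Real.log k) * (mk 1 : ℝ⟦X⟧) ^ (p + 1)) =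
        (l + p + 1) * (l + p).choose p * ((harmonic (l + (p + 1)) : ℝ) - harmonic (p + 1) - γ) +
          (p + 1) * coeff l (mk ε * (mk 1 : ℝ⟦X⟧) ^ (p + 1)) := by
    have hdec : (mk fun k : ℕ => Real.log k) =
        (mk fun k : ℕ => (harmonic k : ℝ)) - C γ * mk 1 + mk ε := by
      ext k
      simp [hε]
    have hch : ((l + p + 1 : ℕ) : ℝ) * (l + p).choose p =
        (l + p + 1).choose (p + 1) * (p + 1) := by
      exact_mod_cast Nat.add_one_mul_choose_eq (l + p) p
    rw [hdec, add_mul (_ - _), sub_mul, mul_assoc, ← pow_succ', map_add, map_sub, coeff_C_mul,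
      coeff_mk_harmonic_mul_mk_one_pow, coeff_mk_one_pow_succ]
    push_cast at hch
    rw [hch, ← add_assoc l p 1]
    ring
  have herr : Tendsto (fun l : ℕ => (p + 1) * coeff l (mk ε * (mk 1 : ℝ⟦X⟧) ^ (p + 1)) /
      (l + p).choose p / (l : ℝ)) atTop (nhds 0) := by
    have habs : Tendsto (fun k => |ε k|) atTop (nhds 0) := by simpa using hε0.abs
    have hb := (tendsto_inv_mul_sum_range_succ_of_tendsto_zero habs).const_mul ((p : ℝ) + 1)
    rw [mul_zero] at hb
    refine squeeze_zero_norm (fun l => ?_) hb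
    have hpos : (0 : ℝ) < (l + p).choose p := by
      exact_mod_cast Nat.choose_pos (Nat.le_add_left p l)
    have hp : (0 : ℝ) ≤ (p : ℝ) + 1 := by positivity
    rw [Real.norm_eq_abs, abs_div, abs_div, abs_mul, Nat.abs_cast, Nat.abs_cast, abs_of_nonneg hp]
    calc _ ≤ (p + 1) * ((l + p).choose p * ∑ k ∈ Finset.range (l + 1), |ε k|) /
          (l + p).choose p / (l : ℝ) := by
          gcongr
          exact abs_coeff_mk_mul_mk_one_pow_succ_le ε p l
      _ = _ := by field_simp
  have hinv := tendsto_inv_atTop_nhds_zero_nat (𝕜 := ℝ)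
  have hcast := tendsto_natCast_atTop_atTop (R := ℝ)
  have hu : Tendsto (fun l : ℕ => ε (l + (p + 1))) atTop (nhds 0) :=
    hε0.comp (tendsto_add_atTop_nat (p + 1))
  have hv : Tendsto (fun l : ℕ => Real.log ((l : ℝ) + (p + 1)) - Real.log l) atTop (nhds 0) :=
    (Real.tendsto_log_comp_add_sub_log ((p : ℝ) + 1)).comp hcast
  have hw : Tendsto (fun l : ℕ => Real.log l / l) atTop (nhds 0) := by
    simpa [Function.comp_def] using
      (Real.tendsto_pow_log_div_mul_add_atTop 1 0 1 one_ne_zero).comp hcast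
  have hmain := ((((hinv.const_mul ((p : ℝ) + 1)).const_add 1).mul
    ((hv.sub hu).sub_const (harmonic (p + 1) : ℝ))).add (hw.const_mul ((p : ℝ) + 1))).add herr
  simp only [mul_zero, add_zero, sub_zero, zero_sub, one_mul] at hmain
  refine hmain.congr' ?_
  filter_upwards [eventually_gt_atTop 0] with l hl
  have hl' : (l : ℝ) ≠ 0 := by positivity
  have hch : ((l + p).choose p : ℝ) ≠ 0 := by
    exact_mod_cast (Nat.choose_pos (Nat.le_add_left p l)).ne'
  rw [hlog]
  simp only [hε]
  push_cast
  field_simp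
  ring

/-- **Asymptotics of the symmetric-power constant.** For fixed `n ≥ 1`, with
`log γ_{n,ℓ} = binom (ℓ+n-1) (n-1)⁻¹ * ∑_{|𝐢| = ℓ} log (ℓ! / 𝐢!)`, one has
`(log γ_{n,ℓ}) / ℓ → Hₙ - 1` as `ℓ → ∞`, where `Hₙ` is the n-th harmonic number. -/
theorem symmetric_power_constant_asymptotic (n : ℕ) (hn : 1 ≤ n) :
    Tendsto (fun l : ℕ =>
        (((Nat.choose (l + n - 1) (n - 1) : ℝ))⁻¹ *
            ∑ i ∈ Finset.Nat.antidiagonalTuple n l,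
              Real.log ((l.factorial : ℝ) / ∏ j, ((i j).factorial : ℝ))) / (l : ℝ))
      atTop (nhds ((∑ i ∈ Finset.range n, (1 : ℝ) / (i + 1)) - 1)) := by
  obtain ⟨p, rfl⟩ := Nat.exists_eq_add_of_le' hn
  have h := (tendsto_coeff_mk_log_mul_mk_one_pow 0).sub (tendsto_coeff_mk_log_mul_mk_one_pow p)
  have hlim : -((harmonic (0 + 1) : ℚ) : ℝ) - -((harmonic (p + 1) : ℚ) : ℝ) =
      (∑ i ∈ Finset.range (p + 1), (1 : ℝ) / (i + 1)) - 1 := by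
    simp [harmonic]
    ring
  rw [hlim] at h
  refine h.congr fun l => ?_
  have hsum : ∑ i ∈ Finset.Nat.antidiagonalTuple (p + 1) l,
      Real.log ((l.factorial : ℝ) / ∏ j, ((i j).factorial : ℝ)) =
      (l + p).choose p * Real.log l.factorial - (p + 1) * PowerSeries.coeff l
        ((PowerSeries.mk fun k : ℕ => Real.log k) * (PowerSeries.mk 1) ^ (p + 1)) := by
    have hlog (i : Fin (p + 1) → ℕ) :
        Real.log ((l.factorial : ℝ) / ∏ j, ((i j).factorial : ℝ)) =
          Real.log l.factorial - ∑ j, Real.log (i j).factorial := by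
      rw [Real.log_div (by positivity) (Finset.prod_ne_zero_iff.2 fun j _ => by positivity),
        Real.log_prod fun j _ => by positivity]
    simp only [hlog, Finset.sum_sub_distrib, Finset.sum_const, nsmul_eq_mul]
    rw [card_antidiagonalTuple_eq_coeff, coeff_mk_one_pow_succ,
      sum_antidiagonalTuple_sum_eq_coeff fun k => Real.log k.factorial, ← mk_log_mul_mk_one,
      mul_assoc, Nat.add_sub_cancel, ← pow_succ']
    push_cast
    ring
  have hch : ((l + p).choose p : ℝ) ≠ 0 := by
    exact_mod_cast (Nat.choose_pos (Nat.le_add_left p l)).ne'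
  rw [hsum, zero_add, pow_one, mk_log_mul_mk_one, PowerSeries.coeff_mk, ← add_assoc,
    Nat.add_sub_cancel, Nat.add_sub_cancel, mul_sub, inv_mul_cancel_left₀ hch]
  simp
  ring
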